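/- Let d ∈ ℕ and r > 1. There is a constant C(r,d) > 0 such that for all n ≥ 2, ϱ_n(W^r_1, L_2) ≤ C(r,d) · n^{-r+1/2} (log n)^{r(d-1) + 1/2}, where the recovery takes place on the torus 𝕋^d with normalized Lebesgue measure. -/

import Mathlib

open MeasureTheory ENNReal Real

noncomputable section

instance : Fact (0 < 2 * Real.pi) := ⟨by positivity⟩

/-- The `d`-dimensional torus `𝕋^d`. -/
abbrev Torus (d : ℕ) := Fin d → AddCircle (2 * Real.pi)

/-- The normalized Lebesgue measure `(2π)^{-d} dx` on `𝕋^d`. -/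
def torusMeasure (d : ℕ) : Measure (Torus d) :=
  (ENNReal.ofReal ((2 * Real.pi) ^ d))⁻¹ • volume

/-- The `L_p` norm `(∫ |f|^p dμ)^{1/p}` (as an extended nonnegative real). -/
def lpNormE {α : Type*} [MeasurableSpace α] (μ : Measure α) (p : ℝ) (f : α → ℂ) : ℝ≥0∞ :=
  (∫⁻ x, (‖f x‖₊ : ℝ≥0∞) ^ p ∂μ) ^ (1 / p)

/-- The univariate Bernoulli kernel `F_r(x) = 1 + 2 ∑_{k=1}^∞ k^{-r} cos(kx - rπ/2)`,
where `cos(kx - rπ/2) = Re(e^{ikx} e^{-irπ/2})`. -/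
def bernoulliKernel1 (r : ℝ) (x : AddCircle (2 * Real.pi)) : ℂ :=
  1 + 2 * ((∑' k : ℕ+, (k : ℝ) ^ (-r) *
      (fourier (k : ℤ) x * Complex.exp (-(r * Real.pi / 2) * Complex.I)).re : ℝ) : ℂ)

/-- The multivariate Bernoulli kernel `F_r(x) = ∏_{j=1}^d F_r(x_j)` on `𝕋^d`. -/
def bernoulliKernel (d : ℕ) (r : ℝ) : Torus d → ℂ :=
  fun x => ∏ j, bernoulliKernel1 r (x j)

/-- The class `W^r_q` of functions representable as `f = φ ∗ F_r` with `‖φ‖_q ≤ 1`. -/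
def Wclass (d : ℕ) (r q : ℝ) : Set (Torus d → ℂ) :=
  {f | ∃ φ : Torus d → ℂ, Measurable φ ∧ lpNormE (torusMeasure d) q φ ≤ 1 ∧
    ∀ x, f x = ∫ y, φ y * bernoulliKernel d r (x - y) ∂(torusMeasure d)}

/-- The error `ϱ_m(F, L_2)` of optimal linear recovery from `m` point samples on `𝕋^d`. -/
def recovE (d : ℕ) (p : ℝ) (F : Set (Torus d → ℂ)) (m : ℕ) : ℝ≥0∞ :=
  ⨅ (ξ : Fin m → Torus d) (Φ : (Fin m → ℂ) →ₗ[ℂ] C(Torus d, ℂ)),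
    ⨆ f : F, lpNormE (torusMeasure d) p (fun x => f.1 x - Φ (fun j => f.1 (ξ j)) x)

/-- The `j`-th of `N` equispaced nodes on the circle. -/
def gridPoint (N j : ℕ) : AddCircle (2 * Real.pi) :=
  ((2 * Real.pi * j / N : ℝ) : AddCircle (2 * Real.pi))

lemma fourier_gridPoint (N j : ℕ) (m : ℤ) :
    fourier m (gridPoint N j) = Complex.exp (2 * Real.pi * Complex.I * m / N) ^ j := by
  rw [gridPoint, fourier_coe_apply, ← Complex.exp_nat_mul]
  congr 1
  have : (Real.pi : ℂ) ≠ 0 := by exact_mod_cast Real.pi_ne_zero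
  push_cast
  field_simp

lemma sum_fourier_gridPoint {N : ℕ} (hN : 0 < N) (m : ℤ) :
    ∑ j ∈ Finset.range N, fourier m (gridPoint N j) = if (N : ℤ) ∣ m then (N : ℂ) else 0 := by
  have hN' : (N : ℂ) ≠ 0 := by exact_mod_cast hN.ne'
  have hpi : (Real.pi : ℂ) ≠ 0 := by exact_mod_cast Real.pi_ne_zero
  simp_rw [fourier_gridPoint]
  set w := Complex.exp (2 * Real.pi * Complex.I * m / N) with hw
  have hw1 : w = 1 ↔ (N : ℤ) ∣ m := by
    rw [hw, Complex.exp_eq_one_iff]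
    refine exists_congr fun l => ?_
    constructor
    · intro h
      have : (m : ℂ) = N * l := by
        have h2 : (2 * Real.pi * Complex.I) * (m : ℂ) = (2 * Real.pi * Complex.I) * (N * l) := by
          field_simp at h
          linear_combination (2 * Real.pi * Complex.I) * h
        exact mul_left_cancel₀ (by simp [hpi]) h2
      exact_mod_cast this
    · rintro rfl
      push_cast
      field_simp
  split_ifs with h
  · simp [hw1.2 h]
  · have hne : w ≠ 1 := fun h' => h (hw1.1 h')
    have hwN : w ^ N = 1 := by
      rw [hw, ← Complex.exp_nat_mul, Complex.exp_eq_one_iff]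
      exact ⟨m, by field_simp⟩
    rw [geom_sum_eq hne, hwN, sub_self, zero_div]

/-- Discrete Fourier coefficient of `g` computed from `N` equispaced samples. -/
def discreteCoeff (N : ℕ) (g : AddCircle (2 * Real.pi) → ℂ) (k : ℤ) : ℂ :=
  (N : ℂ)⁻¹ * ∑ j ∈ Finset.range N, g (gridPoint N j) * fourier (-k) (gridPoint N j)

lemma hasSum_discreteCoeff {c : ℤ → ℂ} {g : AddCircle (2 * Real.pi) → ℂ}
    (hg : ∀ x, HasSum (fun m => c m * fourier m x) (g x)) {N : ℕ} (hN : 0 < N) (k : ℤ) :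
    HasSum (fun l : ℤ => c (k + l * N)) (discreteCoeff N g k) := by
  have hN' : (N : ℂ) ≠ 0 := by exact_mod_cast hN.ne'
  have h1 : HasSum (fun m => if (N : ℤ) ∣ m - k then c m else 0) (discreteCoeff N g k) := by
    have h2 : HasSum (fun m => (N : ℂ)⁻¹ * ∑ j ∈ Finset.range N,
        c m * fourier m (gridPoint N j) * fourier (-k) (gridPoint N j)) (discreteCoeff N g k) :=
      (hasSum_sum fun j _ => (hg _).mul_right _).mul_left _
    refine h2.congr_fun fun m => ?_
    simp_rw [mul_assoc, ← fourier_add, ← Finset.mul_sum, ← sub_eq_add_neg,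
      sum_fourier_gridPoint hN]
    split_ifs
    · field_simp
    · simp
  have hinj : Function.Injective (fun l : ℤ => k + l * N) := by
    intro a b hab
    have : (N : ℤ) ≠ 0 := by exact_mod_cast hN.ne'
    exact mul_right_cancel₀ this (add_left_cancel hab)
  rw [← hinj.hasSum_iff] at h1
  · simpa [Function.comp_def] using h1
  · intro m hm
    rw [if_neg]
    rintro ⟨l, hl⟩
    exact hm ⟨l, by simp only; linarith [mul_comm (N : ℤ) l]⟩

lemma summable_abs_int_rpow_neg {r : ℝ} (hr : 1 < r) :
    Summable (fun l : ℤ => |(l : ℝ)| ^ (-r)) := by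
  exact Real.summable_abs_int_rpow hr

lemma norm_discreteCoeff_sub_le {r : ℝ} (hr : 1 < r) {c : ℤ → ℂ}
    (hc : ∀ m, m ≠ 0 → ‖c m‖ ≤ |(m : ℝ)| ^ (-r)) {g : AddCircle (2 * Real.pi) → ℂ}
    (hg : ∀ x, HasSum (fun m => c m * fourier m x) (g x)) {K : ℕ} (hK : 0 < K) {k : ℤ}
    (hk : |k| ≤ K) :
    ‖discreteCoeff (2 * K) g k - c k‖ ≤ (∑' l : ℤ, |(l : ℝ)| ^ (-r)) * (K : ℝ) ^ (-r) := by
  have h1 := hasSum_discreteCoeff hg (N := 2 * K) (by omega) k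
  have h2 := hasSum_ite_sub_hasSum h1 0
  simp only [zero_mul, add_zero] at h2
  rw [← h2.tsum_eq]
  rw [← tsum_mul_right]
  refine tsum_of_norm_bounded ((summable_abs_int_rpow_neg hr).mul_right _).hasSum fun l => ?_
  split_ifs with hl
  · simp; positivity
  have hK' : (0 : ℝ) < K := by exact_mod_cast hK
  have hl1 : (1 : ℤ) ≤ |l| := Int.one_le_abs hl
  have h3 : (K : ℤ) * |l| ≤ |k + l * (2 * K : ℕ)| := by
    have h4 : |l * ((2 * K : ℕ) : ℤ)| = |l| * (2 * K) := by
      rw [abs_mul]; push_cast; rw [abs_of_nonneg (by positivity : (0 : ℤ) ≤ 2 * K)]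
    have h5 := abs_sub_abs_le_abs_sub (l * ((2 * K : ℕ) : ℤ)) (-k)
    rw [abs_neg, sub_neg_eq_add, add_comm _ k, h4] at h5
    nlinarith
  have h6 : (0 : ℤ) < |k + l * (2 * K : ℕ)| := lt_of_lt_of_le (by positivity) h3
  refine (hc _ (abs_pos.1 h6)).trans ?_
  rw [mul_comm (|(l : ℝ)| ^ (-r)), ← Real.mul_rpow hK'.le (abs_nonneg _)]
  have h7 : (K : ℝ) * |(l : ℝ)| ≤ |((k + l * (2 * K : ℕ) : ℤ) : ℝ)| := by exact_mod_cast h3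
  refine Real.rpow_le_rpow_of_nonpos ?_ h7 (by linarith)
  have : (0 : ℝ) < |(l : ℝ)| := by exact_mod_cast hl1
  positivity

/-- Trigonometric quasi-interpolation of degree `K` from `2 K` equispaced samples. -/
def trigInterp (K : ℕ) (g : AddCircle (2 * Real.pi) → ℂ) (x : AddCircle (2 * Real.pi)) : ℂ :=
  ∑ k ∈ Finset.Icc (-K : ℤ) K, discreteCoeff (2 * K) g k * fourier k x

lemma tendsto_trigInterp {r : ℝ} (hr : 1 < r) {c : ℤ → ℂ}
    (hc : ∀ m, m ≠ 0 → ‖c m‖ ≤ |(m : ℝ)| ^ (-r)) {g : AddCircle (2 * Real.pi) → ℂ}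
    (hg : ∀ x, HasSum (fun m => c m * fourier m x) (g x)) (x : AddCircle (2 * Real.pi)) :
    Filter.Tendsto (fun K => trigInterp K g x) Filter.atTop (nhds (g x)) := by
  set Z := ∑' l : ℤ, |(l : ℝ)| ^ (-r) with hZ
  have h1 : Filter.Tendsto (fun K : ℕ => ∑ k ∈ Finset.Icc (-K : ℤ) K, c k * fourier k x)
      Filter.atTop (nhds (g x)) := by
    have h0 : Filter.Tendsto (fun t : Finset ℤ => ∑ k ∈ t, c k * fourier k x) Filter.atTop
        (nhds (g x)) := hg x
    refine h0.comp ?_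
    refine Filter.tendsto_atTop_finset_of_monotone ?_ ?_
    · intro a b hab
      exact Finset.Icc_subset_Icc (by simpa using hab) (by simpa using hab)
    · intro k
      refine ⟨k.natAbs, ?_⟩
      rw [Finset.mem_Icc]; omega
  have h2 : Filter.Tendsto (fun K : ℕ => trigInterp K g x -
      ∑ k ∈ Finset.Icc (-K : ℤ) K, c k * fourier k x) Filter.atTop (nhds 0) := by
    have h3 : Filter.Tendsto (fun K : ℕ => 3 * Z * (K : ℝ) ^ (-(r - 1)))
        Filter.atTop (nhds 0) := by
      have := ((tendsto_rpow_neg_atTop (by linarith : 0 < r - 1)).comp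
        tendsto_natCast_atTop_atTop).const_mul (3 * Z)
      simpa using this
    refine squeeze_zero_norm' ?_ h3
    filter_upwards [Filter.eventually_gt_atTop 0] with K hK
    have hK' : (1 : ℝ) ≤ K := by exact_mod_cast hK
    rw [trigInterp, ← Finset.sum_sub_distrib]
    have hZ0 : 0 ≤ Z := tsum_nonneg fun l => by positivity
    calc _ ≤ ∑ k ∈ Finset.Icc (-K : ℤ) K, Z * (K : ℝ) ^ (-r) := by
          refine norm_sum_le_of_le _ fun k hk => ?_
          rw [← sub_mul, norm_mul, fourier_apply, Circle.norm_coe, mul_one]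
          refine norm_discreteCoeff_sub_le hr hc hg hK ?_
          rw [Finset.mem_Icc] at hk
          exact abs_le.2 hk
      _ = (2 * K + 1) * (Z * (K : ℝ) ^ (-r)) := by
          rw [Finset.sum_const, Int.card_Icc, nsmul_eq_mul]
          congr 1
          have : ((K : ℤ) + 1 - -K).toNat = 2 * K + 1 := by omega
          rw [this]; push_cast; ring
      _ ≤ (3 * K) * (Z * (K : ℝ) ^ (-r)) := by gcongr; linarith
      _ = _ := by
          rw [show -(r - 1) = 1 + -r by ring, Real.rpow_add (by linarith), Real.rpow_one]; ring
  simpa using h2.add h1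

/-- Dyadic blocks of the quasi-interpolation operators. -/
def trigBlock : ℕ → (AddCircle (2 * Real.pi) → ℂ) → AddCircle (2 * Real.pi) → ℂ
  | 0 => trigInterp 1
  | s + 1 => fun g x => trigInterp (2 ^ (s + 1)) g x - trigInterp (2 ^ s) g x

lemma sum_trigBlock (g : AddCircle (2 * Real.pi) → ℂ) (x : AddCircle (2 * Real.pi)) (M : ℕ) :
    ∑ s ∈ Finset.range (M + 1), trigBlock s g x = trigInterp (2 ^ M) g x := by
  induction M with
  | zero => simp [trigBlock]
  | succ M ih => rw [Finset.sum_range_succ, ih, trigBlock]; ring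

lemma exists_trigBlock_eq {r : ℝ} (hr : 1 < r) :
    ∃ C : ℝ, 0 < C ∧ ∀ (c : ℤ → ℂ) (_ : ‖c 0‖ ≤ 1)
    (_ : ∀ m, m ≠ 0 → ‖c m‖ ≤ |(m : ℝ)| ^ (-r)) (g : AddCircle (2 * Real.pi) → ℂ)
    (_ : ∀ x, HasSum (fun m => c m * fourier m x) (g x)) (s : ℕ),
    ∃ a : ℤ → ℂ, (∀ k, ‖a k‖ ≤ C * ((2 : ℝ) ^ s) ^ (-r)) ∧
      ∀ x, trigBlock s g x =
        ∑ k ∈ Finset.Icc (-(2 ^ s : ℕ) : ℤ) (2 ^ s : ℕ), a k * fourier k x := by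
  set Z := ∑' l : ℤ, |(l : ℝ)| ^ (-r) with hZ
  have hZ0 : 0 ≤ Z := tsum_nonneg fun l => by positivity
  have h2r : (1 : ℝ) ≤ 2 ^ r := Real.one_le_rpow (by norm_num) (by linarith)
  refine ⟨(1 + 2 * Z) * 2 ^ r, by positivity, fun c hc0 hc g hg s => ?_⟩
  cases s with
  | zero =>
    refine ⟨fun k => if |k| ≤ 1 then discreteCoeff 2 g k else 0, fun k => ?_, fun x => ?_⟩
    · simp only
      split_ifs with hk
      · have h1 := norm_discreteCoeff_sub_le hr hc hg (K := 1) one_pos (k := k) (by simpa using hk)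
        have h2 : ‖c k‖ ≤ 1 := by
          by_cases h : k = 0
          · rw [h]; exact hc0
          · refine (hc k h).trans ?_
            have : |(k : ℝ)| = 1 := by
              have := Int.one_le_abs h
              have h3 : |k| = 1 := le_antisymm hk this
              exact_mod_cast h3
            simp [this]
        have h3 := norm_sub_norm_le (discreteCoeff 2 g k) (c k)
        simp only [Nat.cast_one, Real.one_rpow, mul_one] at h1
        simp only [pow_zero, Real.one_rpow, mul_one]
        nlinarith
      · simp; positivity
    · simp only [trigBlock, trigInterp, pow_zero, mul_one]
      refine Finset.sum_congr rfl fun k hk => ?_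
      rw [Finset.mem_Icc] at hk
      rw [if_pos (abs_le.2 (by simpa using hk))]
  | succ s =>
    set a : ℤ → ℂ := fun k =>
      (if |k| ≤ (2 ^ (s + 1) : ℕ) then discreteCoeff (2 * 2 ^ (s + 1)) g k else 0)
      - (if |k| ≤ (2 ^ s : ℕ) then discreteCoeff (2 * 2 ^ s) g k else 0) with ha
    have hpow : ((2 : ℝ) ^ (s : ℕ)) ^ (-r) = 2 ^ r * ((2 : ℝ) ^ (s + 1)) ^ (-r) := by
      rw [pow_succ, Real.mul_rpow (by positivity) (by norm_num),
        Real.rpow_neg (by norm_num : (0 : ℝ) ≤ 2)]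
      field_simp
    have hmono : ((2 : ℝ) ^ (s + 1)) ^ (-r) ≤ ((2 : ℝ) ^ (s : ℕ)) ^ (-r) :=
      Real.rpow_le_rpow_of_nonpos (by positivity)
        (pow_le_pow_right₀ (by norm_num) (by omega)) (by linarith)
    have hbd : ∀ (t : ℕ) (k : ℤ), |k| ≤ (2 ^ t : ℕ) →
        ‖discreteCoeff (2 * 2 ^ t) g k - c k‖ ≤ Z * ((2 : ℝ) ^ t) ^ (-r) := fun t k hk => by
      simpa using norm_discreteCoeff_sub_le hr hc hg (K := 2 ^ t) (by positivity) hk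
    have hp : 0 ≤ ((2 : ℝ) ^ (s : ℕ)) ^ (-r) := by positivity
    refine ⟨a, fun k => ?_, fun x => ?_⟩
    · rw [mul_assoc, ← hpow]
      simp only [ha]
      have hle : (2 ^ s : ℕ) ≤ 2 ^ (s + 1) := Nat.pow_le_pow_right (by norm_num) (by omega)
      have hle' : ((2 ^ s : ℕ) : ℤ) ≤ (2 ^ (s + 1) : ℕ) := by exact_mod_cast hle
      by_cases h1 : |k| ≤ (2 ^ s : ℕ)
      · rw [if_pos h1, if_pos (h1.trans hle')]
        have e1 := hbd s k h1
        have e2 := hbd (s + 1) k (h1.trans hle')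
        have e3 := norm_sub_le (discreteCoeff (2 * 2 ^ (s + 1)) g k - c k)
          (discreteCoeff (2 * 2 ^ s) g k - c k)
        rw [sub_sub_sub_cancel_right] at e3
        nlinarith
      · rw [if_neg h1, sub_zero]
        split_ifs with h2
        · have e2 := hbd (s + 1) k h2
          have e3 := norm_sub_norm_le (discreteCoeff (2 * 2 ^ (s + 1)) g k) (c k)
          have h1' : ((2 ^ s : ℕ) : ℤ) < |k| := not_le.1 h1
          have hk0 : k ≠ 0 := by
            rintro rfl
            simp at h1'
            exact absurd h1' (not_lt.2 (by positivity))
          have e4 : ‖c k‖ ≤ ((2 : ℝ) ^ s) ^ (-r) := by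
            refine (hc k hk0).trans (Real.rpow_le_rpow_of_nonpos (by positivity) ?_ (by linarith))
            exact_mod_cast h1'.le
          nlinarith
        · simp; positivity
    · rw [trigBlock]
      simp only [trigInterp, ha, sub_mul, Finset.sum_sub_distrib]
      congr 1
      · refine Finset.sum_congr rfl fun k hk => ?_
        rw [Finset.mem_Icc] at hk
        rw [if_pos (abs_le.2 hk)]
      · have hle' : ((2 ^ s : ℕ) : ℤ) ≤ (2 ^ (s + 1) : ℕ) := by
          exact_mod_cast Nat.pow_le_pow_right (by norm_num) (by omega)
        rw [← Finset.sum_subset (Finset.Icc_subset_Icc (neg_le_neg hle') hle')]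
        · refine Finset.sum_congr rfl fun k hk => ?_
          rw [Finset.mem_Icc] at hk
          rw [if_pos (abs_le.2 hk)]
        · intro k _ hk
          rw [Finset.mem_Icc] at hk
          rw [if_neg (fun h => hk (abs_le.1 h)), zero_mul]

lemma fourier_sub_arg (m : ℤ) (x y : AddCircle (2 * Real.pi)) :
    fourier m (x - y) = fourier m x * fourier (-m) y := by
  simp [fourier_apply, sub_eq_add_neg, AddCircle.toCircle_add]

/-- Fourier coefficients of the univariate Bernoulli kernel. -/
def bernoulliCoeff (r : ℝ) (m : ℤ) : ℂ :=
  if m = 0 then 1 else (|(m : ℝ)| ^ (-r) : ℝ) *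
    (if 0 < m then Complex.exp (-(r * Real.pi / 2) * Complex.I)
      else Complex.exp ((r * Real.pi / 2) * Complex.I))

lemma norm_bernoulliCoeff (r : ℝ) {m : ℤ} (hm : m ≠ 0) :
    ‖bernoulliCoeff r m‖ = |(m : ℝ)| ^ (-r) := by
  have h1 : ‖Complex.exp (-(r * Real.pi / 2) * Complex.I)‖ = 1 := by
    have := Complex.norm_exp_ofReal_mul_I (-(r * Real.pi / 2))
    push_cast at this; exact this
  have h2 : ‖Complex.exp ((r * Real.pi / 2) * Complex.I)‖ = 1 := by
    have := Complex.norm_exp_ofReal_mul_I (r * Real.pi / 2)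
    push_cast at this; exact this
  rw [bernoulliCoeff, if_neg hm, norm_mul, Complex.norm_real, Real.norm_of_nonneg (by positivity)]
  split_ifs
  · rw [h1, mul_one]
  · rw [h2, mul_one]

lemma hasSum_bernoulliKernel1 {r : ℝ} (hr : 1 < r) (x : AddCircle (2 * Real.pi)) :
    HasSum (fun m => bernoulliCoeff r m * fourier m x) (bernoulliKernel1 r x) := by
  have hs : Summable (fun m : ℤ => bernoulliCoeff r m * fourier m x) := by
    refine Summable.of_norm_bounded_eventually (summable_abs_int_rpow_neg hr) ?_
    have : {(0 : ℤ)}ᶜ ∈ Filter.cofinite := (Set.finite_singleton 0).compl_mem_cofinite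
    filter_upwards [this] with m hm
    rw [norm_mul, fourier_apply, Circle.norm_coe, mul_one, norm_bernoulliCoeff r hm]
  have hsp : Summable (fun k : ℕ+ => bernoulliCoeff r k * fourier (k : ℤ) x) :=
    hs.comp_injective (i := fun k : ℕ+ => (k : ℤ)) (fun a b h => by
      simpa using h)
  have hsn : Summable (fun k : ℕ+ => bernoulliCoeff r (-k) * fourier (-k : ℤ) x) :=
    hs.comp_injective (i := fun k : ℕ+ => (-k : ℤ)) (fun a b h => by
      simpa using h)
  convert hs.hasSum using 1
  rw [tsum_int_eq_zero_add_tsum_pnat hs, add_assoc, ← hsp.tsum_add hsn, bernoulliKernel1]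
  congr 1
  · simp [bernoulliCoeff]
  rw [Complex.ofReal_tsum, ← tsum_mul_left]
  refine tsum_congr fun k => ?_
  have hk : (0 : ℝ) < (k : ℕ) := by exact_mod_cast k.pos
  have hk0 : (0 : ℤ) < ((k : ℕ) : ℤ) := by exact_mod_cast k.pos
  have e1 : bernoulliCoeff r k * fourier (k : ℤ) x = (((k : ℝ) ^ (-r) : ℝ) : ℂ) *
      (fourier (k : ℤ) x * Complex.exp (-(r * Real.pi / 2) * Complex.I)) := by
    rw [bernoulliCoeff, if_neg hk0.ne', if_pos hk0, Int.cast_natCast, abs_of_pos hk]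
    ring
  have e2 : bernoulliCoeff r (-k) * fourier (-k : ℤ) x = (((k : ℝ) ^ (-r) : ℝ) : ℂ) *
      (starRingEnd ℂ) (fourier (k : ℤ) x * Complex.exp (-(r * Real.pi / 2) * Complex.I)) := by
    rw [bernoulliCoeff, if_neg (neg_ne_zero.2 hk0.ne'), if_neg (by omega), Int.cast_neg,
      Int.cast_natCast, abs_neg, abs_of_pos hk, map_mul, ← fourier_neg, ← Complex.exp_conj]
    simp only [map_mul, map_neg, map_div₀, Complex.conj_I, Complex.conj_ofReal, map_ofNat]
    ring_nf
  rw [e1, e2, ← mul_add, Complex.add_conj]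
  push_cast
  ring

/-- The kernel is a trigonometric series with coefficients of size `|m|^{-r}`, as are its
translates. -/
lemma exists_hasSum_translate {r : ℝ} (hr : 1 < r) (y : AddCircle (2 * Real.pi)) :
    ∃ c : ℤ → ℂ, ‖c 0‖ ≤ 1 ∧ (∀ m, m ≠ 0 → ‖c m‖ ≤ |(m : ℝ)| ^ (-r)) ∧
      ∀ x, HasSum (fun m => c m * fourier m x) (bernoulliKernel1 r (x - y)) := by
  refine ⟨fun m => bernoulliCoeff r m * fourier (-m) y, ?_, fun m hm => ?_, fun x => ?_⟩
  · simp [bernoulliCoeff]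
  · rw [norm_mul, fourier_apply, Circle.norm_coe, mul_one, norm_bernoulliCoeff r hm]
  · refine (hasSum_bernoulliKernel1 hr (x - y)).congr_fun fun m => ?_
    rw [fourier_sub_arg]; ring

lemma continuous_bernoulliKernel1 {r : ℝ} (hr : 1 < r) : Continuous (bernoulliKernel1 r) := by
  have h : bernoulliKernel1 r = fun x => ∑' m, bernoulliCoeff r m * fourier m x :=
    funext fun x => (hasSum_bernoulliKernel1 hr x).tsum_eq.symm
  rw [h]
  refine continuous_tsum (u := fun m => ‖bernoulliCoeff r m‖) (fun m => by fun_prop) ?_ ?_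
  · refine Summable.of_norm_bounded_eventually (summable_abs_int_rpow_neg hr) ?_
    have : {(0 : ℤ)}ᶜ ∈ Filter.cofinite := (Set.finite_singleton 0).compl_mem_cofinite
    filter_upwards [this] with m hm
    rw [norm_norm, norm_bernoulliCoeff r hm]
  · intro m x
    rw [norm_mul, fourier_apply, Circle.norm_coe, mul_one]

lemma integral_fourier_mul_conj (k l : ℤ) :
    ∫ x : AddCircle (2 * Real.pi), fourier k x * (starRingEnd ℂ) (fourier l x)
      ∂AddCircle.haarAddCircle = if k = l then 1 else 0 := by
  have h := orthonormal_iff_ite.1 (orthonormal_fourier (T := 2 * Real.pi)) l k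
  rw [fourierLp, fourierLp, ContinuousMap.inner_toLp (AddCircle.haarAddCircle)
    (fourier l) (fourier k)] at h
  simp_rw [eq_comm (a := k), ← h]

lemma norm_integral_trigPoly_mul_conj_le {A B : ℝ} (hA : 0 ≤ A) (K K' : ℕ)
    (a b : ℤ → ℂ) (ha : ∀ k, ‖a k‖ ≤ A) (hb : ∀ k, ‖b k‖ ≤ B) :
    ‖∫ x : AddCircle (2 * Real.pi), (∑ k ∈ Finset.Icc (-K : ℤ) K, a k * fourier k x) *
      (starRingEnd ℂ) (∑ k ∈ Finset.Icc (-K' : ℤ) K', b k * fourier k x)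
      ∂AddCircle.haarAddCircle‖ ≤ (2 * K + 1) * (A * B) := by
  have hint : ∀ k l : ℤ, Integrable (fun x : AddCircle (2 * Real.pi) =>
      (a k * fourier k x) * (starRingEnd ℂ) (b l * fourier l x)) AddCircle.haarAddCircle := by
    intro k l
    refine Continuous.integrable_of_hasCompactSupport ?_ (HasCompactSupport.of_compactSpace _)
    exact (by fun_prop : Continuous fun x => a k * fourier k x).mul
      (Complex.continuous_conj.comp (by fun_prop))
  simp_rw [map_sum, Finset.sum_mul_sum]
  rw [integral_finsetSum _ fun k _ => integrable_finsetSum _ fun l _ => hint k l]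
  have h1 : ∀ k ∈ Finset.Icc (-K : ℤ) K, ‖∫ x : AddCircle (2 * Real.pi),
      ∑ l ∈ Finset.Icc (-K' : ℤ) K', (a k * fourier k x) * (starRingEnd ℂ) (b l * fourier l x)
        ∂AddCircle.haarAddCircle‖ ≤ A * B := by
    intro k _
    rw [integral_finsetSum _ fun l _ => hint k l]
    have h2 : ∀ l, ∫ x : AddCircle (2 * Real.pi), (a k * fourier k x) *
        (starRingEnd ℂ) (b l * fourier l x) ∂AddCircle.haarAddCircle =
        if k = l then a k * (starRingEnd ℂ) (b l) else 0 := by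
      intro l
      have : ∀ x : AddCircle (2 * Real.pi), (a k * fourier k x) *
        (starRingEnd ℂ) (b l * fourier l x) = (a k * (starRingEnd ℂ) (b l)) *
          (fourier k x * (starRingEnd ℂ) (fourier l x)) := by
        intro x; rw [map_mul]; ring
      simp_rw [this]
      rw [integral_const_mul, integral_fourier_mul_conj]
      simp
    simp_rw [h2]
    have hB : 0 ≤ B := (norm_nonneg _).trans (hb 0)
    rw [Finset.sum_ite_eq]
    split_ifs
    · rw [norm_mul, RCLike.norm_conj]
      exact mul_le_mul (ha k) (hb k) (norm_nonneg _) hA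
    · simpa using mul_nonneg hA hB
  refine (norm_sum_le_of_le _ h1).trans (le_of_eq ?_)
  rw [Finset.sum_const, Int.card_Icc, nsmul_eq_mul]
  have : ((K : ℤ) + 1 - -K).toNat = 2 * K + 1 := by omega
  rw [this]; push_cast; ring

/-- Operators of the form `g ↦ ∑ i, g (p i) • h i` built from `m` samples. -/
def IsSampling {X : Type*} [TopologicalSpace X] (L : (X → ℂ) → X → ℂ) (m : ℕ) : Prop :=
  ∃ (p : Fin m → X) (h : Fin m → C(X, ℂ)), ∀ g x, L g x = ∑ i, g (p i) * h i x

lemma IsSampling.sub {X : Type*} [TopologicalSpace X] {L L' : (X → ℂ) → X → ℂ} {m m' : ℕ}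
    (hL : IsSampling L m) (hL' : IsSampling L' m') :
    IsSampling (fun g x => L g x - L' g x) (m + m') := by
  obtain ⟨p, h, hp⟩ := hL
  obtain ⟨p', h', hp'⟩ := hL'
  refine ⟨Fin.append p p', Fin.append h (fun i => -h' i), fun g x => ?_⟩
  simp [Fin.sum_univ_add, hp, hp', sub_eq_add_neg]

lemma isSampling_trigInterp (K : ℕ) : IsSampling (trigInterp K) (2 * K) := by
  refine ⟨fun i => gridPoint (2 * K) i, fun i => (((2 * K : ℕ) : ℂ)⁻¹) •
    ∑ k ∈ Finset.Icc (-K : ℤ) K, (fourier (-k) (gridPoint (2 * K) i)) • fourier k,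
    fun g x => ?_⟩
  simp only [trigInterp, discreteCoeff, ContinuousMap.coe_smul, ContinuousMap.coe_sum,
    Pi.smul_apply, Finset.sum_apply, smul_eq_mul]
  simp_rw [← Fin.sum_univ_eq_sum_range (fun j => g (gridPoint (2 * K) j) *
    fourier (-_) (gridPoint (2 * K) j)), Finset.mul_sum, Finset.sum_mul]
  rw [Finset.sum_comm]
  refine Finset.sum_congr rfl fun i _ => Finset.sum_congr rfl fun k _ => ?_
  ring

lemma exists_isSampling_trigBlock (s : ℕ) : ∃ m ≤ 4 * 2 ^ s, IsSampling (trigBlock s) m := by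
  cases s with
  | zero => exact ⟨2, by norm_num, isSampling_trigInterp 1⟩
  | succ s =>
    refine ⟨2 * 2 ^ (s + 1) + 2 * 2 ^ s, ?_,
      (isSampling_trigInterp (2 ^ (s + 1))).sub (isSampling_trigInterp (2 ^ s))⟩
    rw [pow_succ]; omega

/-- Near-orthogonality of the blocks of translated Bernoulli kernels. -/
lemma exists_norm_integral_trigBlock_le {r : ℝ} (hr : 1 < r) :
    ∃ B : ℝ, 0 < B ∧ ∀ (y : AddCircle (2 * Real.pi)) (s t : ℕ),
      ‖∫ x, trigBlock s (fun z => bernoulliKernel1 r (z - y)) x *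
        (starRingEnd ℂ) (trigBlock t (fun z => bernoulliKernel1 r (z - y)) x)
        ∂AddCircle.haarAddCircle‖ ≤
      B * ((2 ^ (-r) * √2) ^ s * (2 ^ (-r) * √2) ^ t * (√2)⁻¹ ^ Nat.dist s t) := by
  obtain ⟨C, hC, h⟩ := exists_trigBlock_eq hr
  refine ⟨3 * C ^ 2, by positivity, fun y => ?_⟩
  have key : ∀ s t : ℕ, s ≤ t →
      ‖∫ x, trigBlock s (fun z => bernoulliKernel1 r (z - y)) x *
        (starRingEnd ℂ) (trigBlock t (fun z => bernoulliKernel1 r (z - y)) x)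
        ∂AddCircle.haarAddCircle‖ ≤
      3 * C ^ 2 * ((2 ^ (-r) * √2) ^ s * (2 ^ (-r) * √2) ^ t * (√2)⁻¹ ^ Nat.dist s t) := by
    intro s t hst
    obtain ⟨c, hc0, hc, hg⟩ := exists_hasSum_translate hr y
    obtain ⟨a, ha, ha'⟩ := h c hc0 hc _ hg s
    obtain ⟨b, hb, hb'⟩ := h c hc0 hc _ hg t
    simp_rw [ha', hb']
    refine (norm_integral_trigPoly_mul_conj_le (by positivity) _ _ a b ha hb).trans ?_
    obtain ⟨u, rfl⟩ := Nat.exists_eq_add_of_le hst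
    have e : ∀ n : ℕ, ((2 : ℝ) ^ n) ^ (-r) = (2 ^ (-r)) ^ n := fun n => by
      rw [← Real.rpow_natCast, ← Real.rpow_natCast, ← Real.rpow_mul (by norm_num),
        ← Real.rpow_mul (by norm_num), mul_comm]
    rw [e, e, Nat.dist_eq_sub_of_le hst, Nat.add_sub_cancel_left]
    have h2 : √2 * √2 = (2 : ℝ) := Real.mul_self_sqrt (by norm_num)
    have h3 : (√2 : ℝ) ^ u * (√2)⁻¹ ^ u = 1 := by
      rw [← mul_pow, mul_inv_cancel₀ (by positivity), one_pow]
    have h4 : (√2 : ℝ) ^ s * √2 ^ s = 2 ^ s := by rw [← mul_pow, h2]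
    set q : ℝ := 2 ^ (-r)
    have hq : 0 < q := by positivity
    calc _ ≤ (3 * 2 ^ s) * (C * q ^ s * (C * q ^ (s + u))) := by
          gcongr
          push_cast
          have : (1 : ℝ) ≤ 2 ^ s := one_le_pow₀ (by norm_num)
          linarith
      _ = 3 * C ^ 2 * (q ^ s * q ^ (s + u) * (√2 ^ s * √2 ^ s) * (√2 ^ u * (√2)⁻¹ ^ u)) := by
          rw [h3, h4]; ring
      _ = _ := by ring
  intro s t
  rcases le_total s t with hst | hst
  · exact key s t hst
  · have := key t s hst
    rw [← RCLike.norm_conj, ← integral_conj, Nat.dist_comm]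
    simp_rw [map_mul, Complex.conj_conj]
    rw [mul_comm ((2 ^ (-r) * √2) ^ s)]
    refine (le_of_eq ?_).trans this
    congr 2
    ext x
    rw [mul_comm]

lemma continuous_trigInterp (K : ℕ) (g : AddCircle (2 * Real.pi) → ℂ) :
    Continuous (trigInterp K g) := by
  unfold trigInterp
  fun_prop

lemma continuous_trigBlock (s : ℕ) (g : AddCircle (2 * Real.pi) → ℂ) :
    Continuous (trigBlock s g) := by
  cases s with
  | zero => exact continuous_trigInterp _ _
  | succ s => exact (continuous_trigInterp _ _).sub (continuous_trigInterp _ _)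

lemma tendsto_sum_trigBlock {r : ℝ} (hr : 1 < r) (x y : AddCircle (2 * Real.pi)) :
    Filter.Tendsto (fun M => ∑ s ∈ Finset.range M,
      trigBlock s (fun z => bernoulliKernel1 r (z - y)) x) Filter.atTop
      (nhds (bernoulliKernel1 r (x - y))) := by
  obtain ⟨c, hc0, hc, hg⟩ := exists_hasSum_translate hr y
  rw [← Filter.tendsto_add_atTop_iff_nat 1]
  simp_rw [sum_trigBlock]
  exact (tendsto_trigInterp hr hc hg x).comp
    (tendsto_pow_atTop_atTop_of_one_lt (by norm_num))

lemma card_le_of_sum_eq {d k : ℕ} (S : Finset (Fin d → ℕ)) (hS : ∀ s ∈ S, ∑ j, s j = k) :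
    S.card ≤ (k + 1) ^ (d - 1) := by
  cases d with
  | zero => simpa using Finset.card_le_one_of_subsingleton S
  | succ e =>
    have h1 : S.card ≤ (Fintype.piFinset fun _ : Fin e => Finset.range (k + 1)).card := by
      refine Finset.card_le_card_of_injOn (fun s => Fin.tail s) (fun s hs => ?_) ?_
      · have h2 := hS s hs
        rw [Fin.sum_univ_succ] at h2
        simp only [Finset.mem_coe, Fintype.mem_piFinset, Finset.mem_range]
        intro j
        have := Finset.single_le_sum (f := fun i : Fin e => s i.succ) (fun _ _ => Nat.zero_le _)
          (Finset.mem_univ j)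
        simp only [Fin.tail] at this ⊢
        omega
      · intro s hs t ht hst
        have h2 := hS s hs
        have h3 := hS t ht
        rw [Fin.sum_univ_succ] at h2 h3
        have h4 : ∀ i : Fin e, s i.succ = t i.succ := fun i => congrFun hst i
        simp_rw [h4] at h2
        ext i
        refine Fin.cases ?_ h4 i
        omega
    simpa using h1

lemma sum_pow_le_of_le_sum {d : ℕ} {β : ℝ} (hβ0 : 0 ≤ β) (hβ1 : β < 1) :
    ∃ C : ℝ, 0 < C ∧ ∀ (n : ℕ) (S : Finset (Fin d → ℕ)), (∀ s ∈ S, n ≤ ∑ j, s j) →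
      ∑ s ∈ S, β ^ (∑ j, s j) ≤ C * (β ^ n * ((n : ℝ) + 1) ^ (d - 1)) := by
  have hsum : Summable (fun j : ℕ => ((j : ℝ) + 1) ^ (d - 1) * β ^ j) := by
    rcases hβ0.eq_or_lt with h0 | h0
    · refine summable_of_ne_finset_zero (s := {0}) fun j hj => ?_
      rw [← h0, zero_pow (by simpa using hj), mul_zero]
    · have h1 := summable_pow_mul_geometric_of_norm_lt_one (R := ℝ) (d - 1) (r := β)
        (by rwa [Real.norm_of_nonneg hβ0])
      have h2 := ((summable_nat_add_iff 1).2 h1).mul_right β⁻¹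
      refine h2.congr fun j => ?_
      push_cast
      field_simp
      ring
  have hnn : ∀ j : ℕ, 0 ≤ ((j : ℝ) + 1) ^ (d - 1) * β ^ j := fun j => by positivity
  refine ⟨∑' j : ℕ, ((j : ℝ) + 1) ^ (d - 1) * β ^ j, ?_, fun n S hS => ?_⟩
  · exact hsum.tsum_pos hnn 0 (by simp)
  rw [Finset.sum_comp (fun k => β ^ k) (fun s : Fin d → ℕ => ∑ j, s j)]
  have himg : ∀ k ∈ S.image (fun s => ∑ j, s j), n ≤ k := by
    intro k hk
    obtain ⟨s, hs, rfl⟩ := Finset.mem_image.1 hk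
    exact hS s hs
  calc _ ≤ ∑ k ∈ S.image (fun s => ∑ j, s j), (β ^ n * ((n : ℝ) + 1) ^ (d - 1)) *
        ((((k - n : ℕ) : ℝ) + 1) ^ (d - 1) * β ^ (k - n)) := by
        refine Finset.sum_le_sum fun k hk => ?_
        obtain ⟨j, rfl⟩ := Nat.exists_eq_add_of_le (himg k hk)
        rw [Nat.add_sub_cancel_left, nsmul_eq_mul]
        have h1 : ((S.filter (fun s => ∑ i, s i = n + j)).card : ℝ) ≤
            (((n : ℝ) + 1) * ((j : ℝ) + 1)) ^ (d - 1) := by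
          refine le_trans (b := (((n + j + 1 : ℕ) : ℝ)) ^ (d - 1)) ?_ ?_
          · exact_mod_cast card_le_of_sum_eq _ (fun s hs => (Finset.mem_filter.1 hs).2)
          · refine pow_le_pow_left₀ (by positivity) ?_ _
            push_cast
            have : (0 : ℝ) ≤ n * j := by positivity
            linarith
        calc _ ≤ (((n : ℝ) + 1) * ((j : ℝ) + 1)) ^ (d - 1) * β ^ (n + j) := by gcongr
          _ = _ := by rw [mul_pow, pow_add]; ring
    _ = (β ^ n * ((n : ℝ) + 1) ^ (d - 1)) * ∑ j ∈ (S.image (fun s => ∑ j, s j)).image (· - n),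
          ((j : ℝ) + 1) ^ (d - 1) * β ^ j := by
        rw [Finset.mul_sum, Finset.sum_image (g := (· - n))]
        intro a ha b hb hab
        have := himg a ha
        have := himg b hb
        simp only at hab
        omega
    _ ≤ _ := by
        rw [mul_comm]
        gcongr
        exact hsum.sum_le_tsum _ fun j _ => hnn j

/-- The indices of the sparse grid of order `n`. -/
def smolyakIndex (d n : ℕ) : Finset (Fin d → ℕ) :=
  (Fintype.piFinset fun _ => Finset.range n).filter fun s => ∑ j, s j < n

lemma mem_smolyakIndex {d n : ℕ} {s : Fin d → ℕ} : s ∈ smolyakIndex d n ↔ ∑ j, s j < n := by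
  rw [smolyakIndex, Finset.mem_filter, and_iff_right_iff_imp, Fintype.mem_piFinset]
  intro h j
  exact Finset.mem_range.2 (lt_of_le_of_lt
    (Finset.single_le_sum (fun _ _ => Nat.zero_le _) (Finset.mem_univ j)) h)

lemma sum_smolyakIndex_le (d n : ℕ) :
    ∑ s ∈ smolyakIndex d n, 2 ^ (∑ j, s j) ≤ (n + 1) ^ (d - 1) * (2 ^ n - 1) := by
  have hmap : ∀ s ∈ smolyakIndex d n, ∑ j, s j ∈ Finset.range n := fun s hs =>
    Finset.mem_range.2 (mem_smolyakIndex.1 hs)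
  have hgeom : 2 ^ n - 1 = ∑ k ∈ Finset.range n, 2 ^ k := by simp [Nat.geomSum_eq le_rfl n]
  rw [← Finset.sum_fiberwise_of_maps_to hmap, hgeom, Finset.mul_sum]
  refine Finset.sum_le_sum fun k hk => ?_
  have hk' := Finset.mem_range.1 hk
  rw [Finset.sum_congr rfl (g := fun _ => 2 ^ k) fun s hs => by rw [(Finset.mem_filter.1 hs).2],
    Finset.sum_const, smul_eq_mul]
  gcongr
  refine (card_le_of_sum_eq (k := k) _ fun s hs => (Finset.mem_filter.1 hs).2).trans ?_
  gcongr

lemma sum_pow_dist_le {θ : ℝ} (h0 : 0 ≤ θ) (h1 : θ < 1) (s M : ℕ) :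
    ∑ t ∈ Finset.range M, θ ^ Nat.dist s t ≤ 2 * (1 - θ)⁻¹ := by
  have hg : ∀ n, ∑ t ∈ Finset.range n, θ ^ t ≤ (1 - θ)⁻¹ := fun n => by
    rw [← tsum_geometric_of_lt_one h0 h1]
    exact (summable_geometric_of_lt_one h0 h1).sum_le_tsum _ fun _ _ => by positivity
  calc _ ≤ ∑ t ∈ Finset.range (s + M), θ ^ Nat.dist s t :=
        Finset.sum_le_sum_of_subset_of_nonneg (Finset.range_mono (by omega))
          fun _ _ _ => by positivity
    _ = ∑ t ∈ Finset.range s, θ ^ Nat.dist s t + ∑ t ∈ Finset.range M, θ ^ t := by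
        rw [Finset.sum_range_add]
        congr 1
        refine Finset.sum_congr rfl fun t _ => ?_
        rw [Nat.dist_eq_sub_of_le (by omega), Nat.add_sub_cancel_left]
    _ ≤ ∑ t ∈ Finset.range s, θ ^ t + ∑ t ∈ Finset.range M, θ ^ t := by
        gcongr 1
        rw [← Finset.sum_range_reflect]
        refine Finset.sum_le_sum fun t ht => ?_
        have := Finset.mem_range.1 ht
        rw [Nat.dist_eq_sub_of_le_right (by omega)]
        exact pow_le_pow_of_le_one h0 h1.le (by omega)
    _ ≤ _ := by linarith [hg s, hg M]

/-- Bessel-type inequality for nearly orthogonal tensor products. -/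
lemma integral_norm_sq_sum_prod_le {d : ℕ} {X : Type*} [TopologicalSpace X] [CompactSpace X]
    [SecondCountableTopology X] [MeasurableSpace X] [BorelSpace X]
    (ν : Measure X) [IsProbabilityMeasure ν] {B ρ θ : ℝ} (hB : 0 ≤ B)
    (h0 : 0 ≤ θ) (h1 : θ < 1) (u : Fin d → ℕ → X → ℂ) (hu : ∀ j s, Continuous (u j s))
    (hgram : ∀ j s t, ‖∫ x, u j s x * (starRingEnd ℂ) (u j t x) ∂ν‖ ≤
      B * (ρ ^ s * ρ ^ t * θ ^ Nat.dist s t)) (S : Finset (Fin d → ℕ)) :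
    ∫ x, ‖∑ s ∈ S, ∏ j, u j (s j) (x j)‖ ^ 2 ∂(Measure.pi fun _ : Fin d => ν) ≤
      (B * (2 * (1 - θ)⁻¹)) ^ d * ∑ s ∈ S, (ρ ^ 2) ^ (∑ j, s j) := by
  set μ := Measure.pi fun _ : Fin d => ν
  set κ : (Fin d → ℕ) → (Fin d → ℕ) → ℝ := fun s t => ∏ j, θ ^ Nat.dist (s j) (t j)
  have hθ : 0 < (1 - θ)⁻¹ := inv_pos.2 (by linarith)
  have hκ : ∀ s t, 0 ≤ κ s t := fun s t => Finset.prod_nonneg fun j _ => by positivity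
  have hκc : ∀ s t, κ s t = κ t s := fun s t => by simp only [κ, Nat.dist_comm]
  have hκs : ∀ s, ∑ t ∈ S, κ s t ≤ (2 * (1 - θ)⁻¹) ^ d := by
    intro s
    obtain ⟨M, hM⟩ : ∃ M, S ⊆ Fintype.piFinset fun _ => Finset.range M := by
      refine ⟨S.sup (fun t => Finset.univ.sup t) + 1, fun t ht => ?_⟩
      rw [Fintype.mem_piFinset]
      intro j
      rw [Finset.mem_range, Nat.lt_succ_iff]
      exact (Finset.le_sup (f := t) (Finset.mem_univ j)).trans
        (Finset.le_sup (f := fun t : Fin d → ℕ => Finset.univ.sup t) ht)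
    calc _ ≤ ∑ t ∈ Fintype.piFinset fun _ => Finset.range M, κ s t :=
          Finset.sum_le_sum_of_subset_of_nonneg hM fun _ _ _ => hκ _ _
      _ = ∏ j, ∑ t ∈ Finset.range M, θ ^ Nat.dist (s j) t :=
          (Finset.prod_univ_sum (fun _ => Finset.range M)
            (fun (j : Fin d) t => θ ^ Nat.dist (s j) t)).symm
      _ ≤ ∏ _j : Fin d, 2 * (1 - θ)⁻¹ :=
          Finset.prod_le_prod (fun j _ => Finset.sum_nonneg fun _ _ => by positivity)
            fun j _ => sum_pow_dist_le h0 h1 _ _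
      _ = _ := by simp
  have hcont : ∀ s : Fin d → ℕ, Continuous fun x : Fin d → X => ∏ j, u j (s j) (x j) :=
    fun s => continuous_finsetProd _ fun j _ => (hu j _).comp (continuous_apply j)
  have hint : ∀ s t : Fin d → ℕ, Integrable (fun x : Fin d → X =>
      (∏ j, u j (s j) (x j)) * (starRingEnd ℂ) (∏ j, u j (t j) (x j))) μ := fun s t =>
    Continuous.integrable_of_hasCompactSupport
      ((hcont s).mul (Complex.continuous_conj.comp (hcont t))) (HasCompactSupport.of_compactSpace _)
  have h2 : ((∫ x, ‖∑ s ∈ S, ∏ j, u j (s j) (x j)‖ ^ 2 ∂μ : ℝ) : ℂ) =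
      ∑ s ∈ S, ∑ t ∈ S, ∏ j, ∫ x, u j (s j) x * (starRingEnd ℂ) (u j (t j) x) ∂ν := by
    rw [← integral_complex_ofReal]
    simp_rw [Complex.ofReal_pow, ← Complex.mul_conj', map_sum, Finset.sum_mul_sum]
    rw [integral_finsetSum _ fun s _ => integrable_finsetSum _ fun t _ => hint s t]
    refine Finset.sum_congr rfl fun s _ => ?_
    rw [integral_finsetSum _ fun t _ => hint s t]
    refine Finset.sum_congr rfl fun t _ => ?_
    simp_rw [map_prod, ← Finset.prod_mul_distrib]
    exact integral_fintype_prod_eq_prod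
      (fun j x => u j (s j) x * (starRingEnd ℂ) (u j (t j) x))
  have hw : ∀ s t : Fin d → ℕ, ‖∏ j, ∫ x, u j (s j) x * (starRingEnd ℂ) (u j (t j) x) ∂ν‖ ≤
      B ^ d * (κ s t * (ρ ^ 2) ^ (∑ j, s j) / 2 + κ s t * (ρ ^ 2) ^ (∑ j, t j) / 2) := by
    intro s t
    rw [norm_prod]
    calc _ ≤ ∏ j, B * (ρ ^ s j * ρ ^ t j * θ ^ Nat.dist (s j) (t j)) :=
          Finset.prod_le_prod (fun _ _ => norm_nonneg _) fun j _ => hgram j _ _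
      _ = B ^ d * (ρ ^ (∑ j, s j) * ρ ^ (∑ j, t j) * κ s t) := by
          simp [Finset.prod_mul_distrib, Finset.prod_pow_eq_pow_sum, κ]
      _ ≤ _ := by
          gcongr
          rw [← pow_mul, ← pow_mul, mul_comm 2, mul_comm 2, pow_mul, pow_mul]
          nlinarith [mul_nonneg (hκ s t)
            (sq_nonneg (ρ ^ (∑ j, s j) - ρ ^ (∑ j, t j)))]
  have h3 : ∫ x, ‖∑ s ∈ S, ∏ j, u j (s j) (x j)‖ ^ 2 ∂μ ≤ ∑ s ∈ S, ∑ t ∈ S,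
      B ^ d * (κ s t * (ρ ^ 2) ^ (∑ j, s j) / 2 + κ s t * (ρ ^ 2) ^ (∑ j, t j) / 2) := by
    refine (le_abs_self _).trans ?_
    rw [← Real.norm_eq_abs, ← Complex.norm_real, h2]
    exact norm_sum_le_of_le _ fun s _ => norm_sum_le_of_le _ fun t _ => hw s t
  refine h3.trans ?_
  have h4 : ∑ s ∈ S, ∑ t ∈ S, κ s t * (ρ ^ 2) ^ (∑ j, t j) / 2 =
      ∑ s ∈ S, ∑ t ∈ S, κ s t * (ρ ^ 2) ^ (∑ j, s j) / 2 := by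
    rw [Finset.sum_comm]
    simp_rw [hκc]
  simp_rw [← Finset.mul_sum, Finset.sum_add_distrib]
  rw [h4, ← Finset.sum_add_distrib]
  rw [mul_pow, mul_assoc]
  gcongr
  rw [Finset.mul_sum]
  refine Finset.sum_le_sum fun s _ => ?_
  rw [← Finset.sum_add_distrib]
  simp_rw [add_halves]
  rw [← Finset.sum_mul]
  gcongr
  exact hκs s

lemma torusMeasure_eq_pi (d : ℕ) :
    torusMeasure d =
      Measure.pi fun _ : Fin d => (AddCircle.haarAddCircle : Measure (AddCircle (2 * Real.pi))) := by
  have hpos : (0 : ℝ) < 2 * Real.pi := by positivity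
  have h0 : ENNReal.ofReal (2 * Real.pi) ≠ 0 := by simpa using hpos
  refine (Measure.pi_eq fun s hs => ?_).symm
  rw [torusMeasure, Measure.smul_apply, volume_pi_pi, smul_eq_mul]
  simp_rw [AddCircle.volume_eq_smul_haarAddCircle, Measure.smul_apply, smul_eq_mul]
  rw [Finset.prod_mul_distrib, Finset.prod_const, Finset.card_univ, Fintype.card_fin, ← mul_assoc,
    ENNReal.ofReal_pow hpos.le, ENNReal.inv_mul_cancel (pow_ne_zero _ h0)
      (ENNReal.pow_ne_top ENNReal.ofReal_ne_top), one_mul]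

instance isProbabilityMeasure_torusMeasure (d : ℕ) : IsProbabilityMeasure (torusMeasure d) := by
  rw [torusMeasure_eq_pi]
  infer_instance

lemma isSampling_of_fintype {X ι : Type*} [TopologicalSpace X] [Fintype ι]
    {L : (X → ℂ) → X → ℂ} (p : ι → X) (h : ι → C(X, ℂ))
    (hL : ∀ g x, L g x = ∑ i, g (p i) * h i x) : IsSampling L (Fintype.card ι) := by
  refine ⟨fun i => p ((Fintype.equivFin ι).symm i), fun i => h ((Fintype.equivFin ι).symm i),
    fun g x => ?_⟩
  rw [hL]
  exact ((Fintype.equivFin ι).symm.sum_comp fun i => g (p i) * h i x).symm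

/-- The Smolyak algorithm for the one-dimensional operators `trigBlock`. -/
lemma exists_smolyak (d n : ℕ) :
    ∃ (N : ℕ) (L : (Torus d → ℂ) → Torus d → ℂ), N ≤ 4 ^ d * ((n + 1) ^ (d - 1) * (2 ^ n - 1)) ∧
      IsSampling L N ∧ ∀ (f : Fin d → AddCircle (2 * Real.pi) → ℂ) (x : Torus d),
        L (fun z => ∏ j, f j (z j)) x =
          ∑ s ∈ smolyakIndex d n, ∏ j, trigBlock (s j) (f j) (x j) := by
  choose m hm p h hp using exists_isSampling_trigBlock
  let pt (i : Σ s : smolyakIndex d n, ∀ j, Fin (m (s.1 j))) : Torus d :=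
    fun j => p (i.1.1 j) (i.2 j)
  let ht (i : Σ s : smolyakIndex d n, ∀ j, Fin (m (s.1 j))) : C(Torus d, ℂ) :=
    ⟨fun x => ∏ j, h (i.1.1 j) (i.2 j) (x j), by fun_prop⟩
  refine ⟨_, fun g x => ∑ i, g (pt i) * ht i x, ?_,
    isSampling_of_fintype pt ht fun g x => rfl, fun f x => ?_⟩
  · rw [Fintype.card_sigma]
    simp_rw [Fintype.card_pi, Fintype.card_fin]
    rw [Finset.sum_coe_sort (smolyakIndex d n) fun s => ∏ j, m (s j)]
    calc _ ≤ ∑ s ∈ smolyakIndex d n, 4 ^ d * 2 ^ (∑ j, s j) := by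
          refine Finset.sum_le_sum fun s _ => ?_
          refine (Finset.prod_le_prod' fun j _ => hm (s j)).trans (le_of_eq ?_)
          rw [Finset.prod_mul_distrib, Finset.prod_pow_eq_pow_sum]
          simp
      _ ≤ _ := by
          rw [← Finset.mul_sum]
          exact Nat.mul_le_mul_left _ (sum_smolyakIndex_le d n)
  · simp_rw [hp]
    rw [Fintype.sum_sigma]
    refine Eq.trans ?_ (Finset.sum_coe_sort (smolyakIndex d n) fun s => ∏ j, ∑ i : Fin (m (s j)),
      f j (p (s j) i) * h (s j) i (x j))
    refine Finset.sum_congr rfl fun s _ => ?_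
    rw [Finset.prod_univ_sum, Fintype.piFinset_univ]
    simp_rw [Finset.prod_mul_distrib]
    rfl

lemma lintegral_enorm_sq_eq {X : Type*} [TopologicalSpace X] [CompactSpace X]
    [MeasurableSpace X] [BorelSpace X] (μ : Measure X) [IsFiniteMeasure μ] {f : X → ℂ}
    (hf : Continuous f) : ∫⁻ x, ‖f x‖ₑ ^ 2 ∂μ = ENNReal.ofReal (∫ x, ‖f x‖ ^ 2 ∂μ) := by
  rw [ofReal_integral_eq_lintegral_ofReal]
  · refine lintegral_congr fun x => ?_
    rw [ENNReal.ofReal_pow (norm_nonneg _), ofReal_norm]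
  · exact (hf.norm.pow 2).integrable_of_hasCompactSupport (HasCompactSupport.of_compactSpace _)
  · exact Filter.Eventually.of_forall fun x => by positivity

/-- Mean square error of the Smolyak algorithm on the translates of the Bernoulli kernel. -/
lemma exists_smolyak_error_le (d : ℕ) {r : ℝ} (hr : 1 < r) :
    ∃ C : ℝ, 0 < C ∧ ∀ (n : ℕ) (y : Torus d),
      ∫⁻ x, ‖bernoulliKernel d r (x - y) - ∑ s ∈ smolyakIndex d n, ∏ j, trigBlock (s j)
        (fun z => bernoulliKernel1 r (z - y j)) (x j)‖ₑ ^ 2 ∂(torusMeasure d) ≤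
      ENNReal.ofReal (C * (((2 : ℝ) ^ (1 - 2 * r)) ^ n * ((n : ℝ) + 1) ^ (d - 1))) := by
  obtain ⟨B, hB, hgram⟩ := exists_norm_integral_trigBlock_le hr
  have hβ : ((2 : ℝ) ^ (-r) * √2) ^ 2 = 2 ^ (1 - 2 * r) := by
    rw [mul_pow, Real.sq_sqrt (by norm_num), ← Real.rpow_natCast, ← Real.rpow_mul (by norm_num),
      sub_eq_neg_add, Real.rpow_add (by norm_num), Real.rpow_one]
    congr 2; push_cast; ring
  have hβ1 : (2 : ℝ) ^ (1 - 2 * r) < 1 :=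
    Real.rpow_lt_one_of_one_lt_of_neg (by norm_num) (by linarith)
  have hθ1 : (√2 : ℝ)⁻¹ < 1 := inv_lt_one_of_one_lt₀ (Real.one_lt_sqrt_two)
  obtain ⟨C, hC, hsum⟩ := sum_pow_le_of_le_sum (d := d) (β := (2 : ℝ) ^ (1 - 2 * r))
    (by positivity) hβ1
  have hθ : 0 < (1 - (√2 : ℝ)⁻¹)⁻¹ := inv_pos.2 (by linarith)
  refine ⟨(B * (2 * (1 - (√2)⁻¹)⁻¹)) ^ d * C, by positivity, fun n y => ?_⟩
  set u : Fin d → ℕ → AddCircle (2 * Real.pi) → ℂ :=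
    fun j s => trigBlock s fun z => bernoulliKernel1 r (z - y j) with hu
  have huc : ∀ j s, Continuous (u j s) := fun j s => continuous_trigBlock _ _
  have hcont : ∀ S : Finset (Fin d → ℕ), Continuous fun x : Torus d =>
      ∑ s ∈ S, ∏ j, u j (s j) (x j) := fun S =>
    continuous_finsetSum _ fun s _ => continuous_finsetProd _ fun j _ =>
      (huc j _).comp (continuous_apply j)
  have hlim : ∀ x : Torus d, Filter.Tendsto (fun M : ℕ =>
      ‖∑ s ∈ Fintype.piFinset (fun _ => Finset.range M), ∏ j, u j (s j) (x j) -
        ∑ s ∈ smolyakIndex d n, ∏ j, u j (s j) (x j)‖ₑ ^ 2) Filter.atTop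
      (nhds (‖bernoulliKernel d r (x - y) -
        ∑ s ∈ smolyakIndex d n, ∏ j, u j (s j) (x j)‖ₑ ^ 2)) := by
    intro x
    have h1 : Filter.Tendsto (fun M : ℕ => ∏ j, ∑ s ∈ Finset.range M, u j s (x j)) Filter.atTop
        (nhds (bernoulliKernel d r (x - y))) :=
      tendsto_finsetProd _ fun j _ => tendsto_sum_trigBlock hr (x j) (y j)
    simp_rw [Finset.prod_univ_sum] at h1
    exact ((ENNReal.continuous_pow 2).tendsto _).comp (h1.sub_const _).enorm
  calc _ = ∫⁻ x, Filter.liminf (fun M : ℕ =>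
        ‖∑ s ∈ Fintype.piFinset (fun _ => Finset.range M), ∏ j, u j (s j) (x j) -
          ∑ s ∈ smolyakIndex d n, ∏ j, u j (s j) (x j)‖ₑ ^ 2) Filter.atTop ∂(torusMeasure d) :=
        lintegral_congr fun x => ((hlim x).liminf_eq).symm
    _ ≤ Filter.liminf (fun M : ℕ => ∫⁻ x,
        ‖∑ s ∈ Fintype.piFinset (fun _ => Finset.range M), ∏ j, u j (s j) (x j) -
          ∑ s ∈ smolyakIndex d n, ∏ j, u j (s j) (x j)‖ₑ ^ 2 ∂(torusMeasure d)) Filter.atTop :=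
        lintegral_liminf_le fun M =>
          ((hcont _).sub (hcont _)).enorm.measurable.pow_const 2
    _ ≤ _ := by
        refine Filter.liminf_le_of_frequently_le' (Filter.Eventually.frequently ?_)
        filter_upwards [Filter.eventually_ge_atTop n] with M hM
        have hsub : smolyakIndex d n ⊆ Fintype.piFinset fun _ => Finset.range M := by
          refine (Finset.filter_subset _ _).trans (Fintype.piFinset_subset _ _ fun _ => ?_)
          exact Finset.range_mono hM
        simp_rw [← Finset.sum_sdiff_eq_sub hsub]
        rw [lintegral_enorm_sq_eq _ (hcont _), torusMeasure_eq_pi]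
        refine ENNReal.ofReal_le_ofReal ?_
        refine (integral_norm_sq_sum_prod_le _ hB.le (by positivity) hθ1 u huc
          (fun j s t => hgram (y j) s t) _).trans ?_
        rw [hβ, mul_assoc]
        gcongr
        refine hsum n _ fun s hs => ?_
        rw [Finset.mem_sdiff, mem_smolyakIndex] at hs
        exact not_lt.1 hs.2

lemma continuous_bernoulliKernel (d : ℕ) {r : ℝ} (hr : 1 < r) :
    Continuous (bernoulliKernel d r) :=
  continuous_finsetProd _ fun j _ => (continuous_bernoulliKernel1 hr).comp (continuous_apply j)

lemma sq_lintegral_mul_le {X : Type*} [MeasurableSpace X] (μ : Measure X) {a b : X → ℝ≥0∞}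
    (ha : Measurable a) (hb : Measurable b) (h1 : ∫⁻ y, a y ∂μ ≤ 1) :
    (∫⁻ y, a y * b y ∂μ) ^ 2 ≤ ∫⁻ y, a y * b y ^ 2 ∂μ := by
  have h := ENNReal.lintegral_mul_norm_pow_le (μ := μ) ha.aemeasurable
    (ha.mul (hb.pow_const 2)).aemeasurable (p := 1 / 2) (q := 1 / 2) (by norm_num) (by norm_num)
    (by norm_num)
  have h2 : ∀ y, a y ^ (1 / 2 : ℝ) * (a y * b y ^ 2) ^ (1 / 2 : ℝ) = a y * b y := fun y => by
    rw [← ENNReal.mul_rpow_of_nonneg _ _ (by norm_num : (0 : ℝ) ≤ 1 / 2),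
      show a y * (a y * b y ^ 2) = (a y * b y) ^ 2 by ring, ← ENNReal.rpow_natCast,
      ← ENNReal.rpow_mul]
    norm_num
  simp only [Pi.mul_apply, h2] at h
  calc _ ≤ ((∫⁻ y, a y ∂μ) ^ (1 / 2 : ℝ) * (∫⁻ y, a y * b y ^ 2 ∂μ) ^ (1 / 2 : ℝ)) ^ 2 := by
        gcongr
    _ ≤ (1 * (∫⁻ y, a y * b y ^ 2 ∂μ) ^ (1 / 2 : ℝ)) ^ 2 := by
        gcongr
        exact ENNReal.rpow_le_one h1 (by norm_num)
    _ = _ := by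
        rw [one_mul, ← ENNReal.rpow_natCast, ← ENNReal.rpow_mul]
        norm_num

/-- The error on the class `W^r_1` is controlled by the error on the translated kernels. -/
lemma recovE_Wclass_one_le {d : ℕ} {r : ℝ} (hr : 1 < r) {L : (Torus d → ℂ) → Torus d → ℂ}
    {N m : ℕ} (hL : IsSampling L N) (hNm : N ≤ m) {E : ℝ≥0∞}
    (hE : ∀ y, ∫⁻ x, ‖bernoulliKernel d r (x - y) - L (fun z => bernoulliKernel d r (z - y)) x‖ₑ ^ 2
      ∂(torusMeasure d) ≤ E) :
    recovE d 2 (Wclass d r 1) m ≤ E ^ (1 / 2 : ℝ) := by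
  obtain ⟨p, h, hp⟩ := hL
  let e : Fin N → Fin m := Fin.castLE hNm
  let ξ : Fin m → Torus d := fun i => if hi : (i : ℕ) < N then p ⟨i, hi⟩ else 0
  have hξ : ∀ i, ξ (e i) = p i := fun i => by simp [ξ, e]
  let Φ : (Fin m → ℂ) →ₗ[ℂ] C(Torus d, ℂ) :=
    ∑ i, (LinearMap.proj (e i) : (Fin m → ℂ) →ₗ[ℂ] ℂ).smulRight (h i)
  have hΦ : ∀ (f : Torus d → ℂ) x, Φ (fun j => f (ξ j)) x = L f x := fun f x => by
    simp [Φ, hp, hξ, LinearMap.sum_apply, ContinuousMap.sum_apply]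
  refine (iInf_le _ ξ).trans ((iInf_le _ Φ).trans (iSup_le ?_))
  rintro ⟨f, φ, hφm, hφ1, hf⟩
  simp only [hΦ]
  have hφ1' : ∫⁻ y, ‖φ y‖ₑ ∂(torusMeasure d) ≤ 1 := by
    simpa [lpNormE, enorm_eq_nnnorm] using hφ1
  have hφi : Integrable φ (torusMeasure d) :=
    ⟨hφm.aestronglyMeasurable, hφ1'.trans_lt ENNReal.one_lt_top⟩
  have hK := continuous_bernoulliKernel d hr
  obtain ⟨A, hA⟩ : ∃ A, ∀ x, ‖bernoulliKernel d r x‖ ≤ A := by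
    obtain ⟨A, hA⟩ := isCompact_univ.exists_bound_of_continuousOn hK.continuousOn
    exact ⟨A, fun x => hA x (Set.mem_univ x)⟩
  have hint : ∀ x, Integrable (fun y => φ y * bernoulliKernel d r (x - y)) (torusMeasure d) :=
    fun x => hφi.mul_bdd (c := A)
      (hK.comp (continuous_const.sub continuous_id)).aestronglyMeasurable
      (Filter.Eventually.of_forall fun y => hA _)
  set G : Torus d → Torus d → ℂ := fun x y => bernoulliKernel d r (x - y) -
    L (fun z => bernoulliKernel d r (z - y)) x with hG
  have hGc : Continuous (Function.uncurry G) := by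
    simp only [hG, hp]
    refine (hK.comp (continuous_fst.sub continuous_snd)).sub ?_
    exact continuous_finsetSum _ fun i _ =>
      (hK.comp (continuous_const.sub continuous_snd)).mul ((h i).continuous.comp continuous_fst)
  have herr : ∀ x, f x - L f x = ∫ y, φ y * G x y ∂(torusMeasure d) := fun x => by
    simp only [hG, hp, hf, mul_sub, Finset.mul_sum]
    rw [integral_sub (hint x), integral_finsetSum]
    · simp_rw [← mul_assoc, integral_mul_const]
    · intro i _
      simp_rw [← mul_assoc]
      exact (hint (p i)).mul_const _
    · refine integrable_finsetSum _ fun i _ => ?_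
      simp_rw [← mul_assoc]
      exact (hint (p i)).mul_const _
  have hGm : Measurable (Function.uncurry G) := hGc.measurable
  simp only [lpNormE]
  gcongr
  calc _ = ∫⁻ x, ‖∫ y, φ y * G x y ∂(torusMeasure d)‖ₑ ^ 2 ∂(torusMeasure d) := by
        simp_rw [herr, enorm_eq_nnnorm, ENNReal.rpow_ofNat]
    _ ≤ ∫⁻ x, ∫⁻ y, ‖φ y‖ₑ * ‖G x y‖ₑ ^ 2 ∂(torusMeasure d) ∂(torusMeasure d) := by
        refine lintegral_mono fun x => ?_
        refine le_trans ?_ (sq_lintegral_mul_le _ hφm.enorm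
          (hGm.comp measurable_prodMk_left).enorm hφ1')
        gcongr
        refine (enorm_integral_le_lintegral_enorm _).trans (le_of_eq ?_)
        simp [enorm_mul]
    _ = ∫⁻ y, ‖φ y‖ₑ * ∫⁻ x, ‖G x y‖ₑ ^ 2 ∂(torusMeasure d) ∂(torusMeasure d) := by
        rw [lintegral_lintegral_swap]
        · refine lintegral_congr fun y => ?_
          exact lintegral_const_mul _ ((hGm.comp measurable_prodMk_right).enorm.pow_const 2)
        · exact ((hφm.comp measurable_snd).enorm.mul (hGm.enorm.pow_const 2)).aemeasurable
    _ ≤ ∫⁻ y, ‖φ y‖ₑ * E ∂(torusMeasure d) := by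
        gcongr with y
        exact hE y
    _ ≤ 1 * E := by
        rw [lintegral_mul_const _ hφm.enorm]
        gcongr
    _ = E := one_mul E

lemma exists_smolyak_order {A : ℕ} (hA : 0 < A) (e : ℕ) {m : ℕ} (hm : 2 ≤ m) :
    ∃ n : ℕ, A * ((n + 1) ^ e * (2 ^ n - 1)) ≤ m ∧
      (m : ℝ) ≤ 2 * A * ((n : ℝ) + 2) ^ e * 2 ^ n ∧ (n : ℝ) + 2 ≤ 4 / Real.log 2 * Real.log m := by
  have hex : ∃ n : ℕ, m < A * ((n + 2) ^ e * (2 ^ (n + 1) - 1)) := by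
    refine ⟨m, ?_⟩
    have h1 : m + 1 < 2 ^ (m + 1) := Nat.lt_two_pow_self
    have h2 : 1 ≤ (m + 2) ^ e := Nat.one_le_pow _ _ (by omega)
    have h3 : m < 2 ^ (m + 1) - 1 := by omega
    calc m < 1 * (1 * (2 ^ (m + 1) - 1)) := by simpa using h3
      _ ≤ _ := by gcongr; omega
  classical
  set n := Nat.find hex with hn
  have hspec := Nat.find_spec hex
  have hle : A * ((n + 1) ^ e * (2 ^ n - 1)) ≤ m := by
    rcases Nat.eq_zero_or_pos n with h0 | h0
    · simp [h0]
    · have := Nat.find_min hex (m := n - 1) (by omega)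
      rw [not_lt, show n - 1 + 2 = n + 1 by omega, show n - 1 + 1 = n by omega] at this
      exact this
  refine ⟨n, hle, ?_, ?_⟩
  · have h1 : m ≤ A * ((n + 2) ^ e * 2 ^ (n + 1)) :=
      hspec.le.trans (Nat.mul_le_mul_left _ (Nat.mul_le_mul_left _ (Nat.sub_le _ _)))
    have h2 : (m : ℝ) ≤ A * (((n : ℝ) + 2) ^ e * 2 ^ (n + 1)) := by exact_mod_cast h1
    refine h2.trans (le_of_eq ?_)
    rw [pow_succ]; ring
  · have h1 : 2 ^ n - 1 ≤ m := by
      refine le_trans ?_ hle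
      calc 2 ^ n - 1 = 1 * (1 * (2 ^ n - 1)) := by ring
        _ ≤ _ := by
          have h2 : 1 ≤ (n + 1) ^ e := Nat.one_le_pow _ _ (by omega)
          gcongr
          omega
    have h2 : 2 ^ n ≤ m ^ 2 := by
      have : 2 ^ n ≤ m + 1 := by omega
      nlinarith
    have h3 : (2 : ℝ) ^ n ≤ (m : ℝ) ^ 2 := by exact_mod_cast h2
    have h4 := Real.log_le_log (by positivity) h3
    rw [Real.log_pow, Real.log_pow] at h4
    have hm' : (2 : ℝ) ≤ m := by exact_mod_cast hm
    have h5 := Real.log_le_log (by norm_num) hm'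
    have h6 : 0 < Real.log 2 := Real.log_pos (by norm_num)
    rw [div_mul_eq_mul_div, le_div_iff₀ h6]
    push_cast at h4
    linarith

lemma exists_rate_le {r A C : ℝ} (hr : 1 < r) (hA : 0 < A) (hC : 0 < C) (e : ℕ) :
    ∃ K : ℝ, 0 < K ∧ ∀ (m n : ℕ), 2 ≤ m → (m : ℝ) ≤ 2 * A * ((n : ℝ) + 2) ^ e * 2 ^ n →
      (n : ℝ) + 2 ≤ 4 / Real.log 2 * Real.log m →
      (C * (((2 : ℝ) ^ (1 - 2 * r)) ^ n * ((n : ℝ) + 1) ^ e)) ^ (1 / 2 : ℝ) ≤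
        K * (m : ℝ) ^ (-r + 1 / 2) * Real.log m ^ (r * e + 1 / 2) := by
  have hlog2 : 0 < Real.log 2 := Real.log_pos (by norm_num)
  set c := 4 / Real.log 2 with hc
  have hc0 : 0 < c := by positivity
  set D := C * ((2 * A) ^ (2 * r - 1) * c ^ (2 * r * e)) with hD
  have hD0 : 0 < D := by positivity
  refine ⟨D ^ (1 / 2 : ℝ) * (Real.log 2) ^ (-(1 / 2) : ℝ), by positivity, fun m n hm h1 h2 => ?_⟩
  have hm' : (2 : ℝ) ≤ m := by exact_mod_cast hm
  have hm0 : (0 : ℝ) < m := by linarith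
  have hl := Real.log_le_log (by norm_num) hm'
  have hlm : 0 < Real.log m := hlog2.trans_le hl
  set ℓ := Real.log m with hℓ
  have hn2 : (0 : ℝ) < (n : ℝ) + 2 := by positivity
  have h3 : (m : ℝ) * ((2 * A) * ((n : ℝ) + 2) ^ e)⁻¹ ≤ 2 ^ n := by
    rw [← div_eq_mul_inv, div_le_iff₀ (by positivity)]
    linarith
  have h4 : ((2 : ℝ) ^ (1 - 2 * r)) ^ n ≤
      (m : ℝ) ^ (1 - 2 * r) * ((2 * A) ^ (2 * r - 1) * ((n : ℝ) + 2) ^ (e * (2 * r - 1))) := by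
    calc ((2 : ℝ) ^ (1 - 2 * r)) ^ n = ((2 : ℝ) ^ n) ^ (1 - 2 * r) := by
          rw [← Real.rpow_natCast, ← Real.rpow_natCast, ← Real.rpow_mul (by norm_num),
            ← Real.rpow_mul (by norm_num), mul_comm]
      _ ≤ ((m : ℝ) * ((2 * A) * ((n : ℝ) + 2) ^ e)⁻¹) ^ (1 - 2 * r) :=
          Real.rpow_le_rpow_of_nonpos (by positivity) h3 (by linarith)
      _ = _ := by
          rw [Real.mul_rpow (by positivity) (by positivity), Real.inv_rpow (by positivity),
            ← Real.rpow_neg (by positivity), neg_sub,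
            Real.mul_rpow (by positivity) (by positivity), ← Real.rpow_natCast ((n : ℝ) + 2),
            ← Real.rpow_mul hn2.le]
  have h5 : C * (((2 : ℝ) ^ (1 - 2 * r)) ^ n * ((n : ℝ) + 1) ^ e) ≤
      D * ((m : ℝ) ^ (1 - 2 * r) * ℓ ^ (2 * r * e)) := by
    have h6 : ((n : ℝ) + 1) ^ e ≤ ((n : ℝ) + 2) ^ (e : ℝ) := by
      rw [Real.rpow_natCast]; gcongr; norm_num
    have h7 : ((n : ℝ) + 2) ^ (2 * r * e) ≤ c ^ (2 * r * e) * ℓ ^ (2 * r * e) := by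
      rw [← Real.mul_rpow hc0.le hlm.le]
      exact Real.rpow_le_rpow hn2.le h2 (by positivity)
    calc _ ≤ C * (((m : ℝ) ^ (1 - 2 * r) * ((2 * A) ^ (2 * r - 1) *
          ((n : ℝ) + 2) ^ (e * (2 * r - 1)))) * ((n : ℝ) + 2) ^ (e : ℝ)) := by gcongr
      _ = C * ((m : ℝ) ^ (1 - 2 * r) * ((2 * A) ^ (2 * r - 1) * ((n : ℝ) + 2) ^ (2 * r * e))) := by
          rw [show 2 * r * (e : ℝ) = e * (2 * r - 1) + e by ring, Real.rpow_add hn2]; ring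
      _ ≤ C * ((m : ℝ) ^ (1 - 2 * r) * ((2 * A) ^ (2 * r - 1) *
          (c ^ (2 * r * e) * ℓ ^ (2 * r * e)))) := by gcongr
      _ = _ := by rw [hD]; ring
  calc _ ≤ (D * ((m : ℝ) ^ (1 - 2 * r) * ℓ ^ (2 * r * e))) ^ (1 / 2 : ℝ) :=
        Real.rpow_le_rpow (by positivity) h5 (by norm_num)
    _ = D ^ (1 / 2 : ℝ) * ((m : ℝ) ^ (-r + 1 / 2) * ℓ ^ (r * e)) := by
        rw [Real.mul_rpow hD0.le (by positivity),
          Real.mul_rpow (x := (m : ℝ) ^ (1 - 2 * r)) (by positivity) (by positivity),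
          ← Real.rpow_mul hm0.le, ← Real.rpow_mul hlm.le]
        congr 3 <;> ring_nf
    _ = D ^ (1 / 2 : ℝ) * (m : ℝ) ^ (-r + 1 / 2) * ℓ ^ (r * e) * 1 := by ring
    _ ≤ D ^ (1 / 2 : ℝ) * (m : ℝ) ^ (-r + 1 / 2) * ℓ ^ (r * e) *
          ((Real.log 2) ^ (-(1 / 2) : ℝ) * ℓ ^ (1 / 2 : ℝ)) := by
        gcongr
        rw [Real.rpow_neg hlog2.le, inv_mul_eq_div, one_le_div (by positivity)]
        exact Real.rpow_le_rpow hlog2.le hl (by norm_num)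
    _ = _ := by rw [Real.rpow_add hlm]; ring

lemma recovE_zero_dim (F : Set (Torus 0 → ℂ)) {m : ℕ} (hm : 0 < m) : recovE 0 2 F m = 0 := by
  let Φ : (Fin m → ℂ) →ₗ[ℂ] C(Torus 0, ℂ) :=
    (LinearMap.proj ⟨0, hm⟩ : (Fin m → ℂ) →ₗ[ℂ] ℂ).smulRight 1
  refine le_antisymm ((iInf_le _ fun _ => 0).trans ((iInf_le _ Φ).trans (iSup_le fun f => ?_)))
    zero_le
  have : ∀ x : Torus 0, f.1 x - Φ (fun _ => f.1 0) x = 0 := fun x => by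
    simp [Φ, Subsingleton.elim x 0]
  change lpNormE (torusMeasure 0) 2 (fun x => f.1 x - Φ (fun _ => f.1 0) x) ≤ 0
  rw [funext this]
  simp [lpNormE]

/-- **Recovery of `W^r_1`.** For `r > 1`,
`ϱ_n(W^r_1, L_2) ≤ C(r,d) n^{-r+1/2} (log n)^{r(d-1) + 1/2}`. -/
theorem recovery_W_r_1 (d : ℕ) (r : ℝ) (hr : 1 < r) :
    ∃ C : ℝ, 0 < C ∧
      ∀ n : ℕ, 2 ≤ n →
        recovE d 2 (Wclass d r 1) n ≤
          ENNReal.ofReal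
            (C * (n : ℝ) ^ (-r + 1 / 2) * Real.log n ^ (r * ((d : ℝ) - 1) + 1 / 2)) := by
  rcases Nat.eq_zero_or_pos d with rfl | hd
  · refine ⟨1, one_pos, fun n hn => ?_⟩
    rw [recovE_zero_dim _ (by omega)]
    exact zero_le
  obtain ⟨C, hC, herr⟩ := exists_smolyak_error_le d hr
  obtain ⟨K, hK, hrate⟩ := exists_rate_le hr (A := ((4 ^ d : ℕ) : ℝ)) (by positivity) hC (d - 1)
  refine ⟨K, hK, fun m hm => ?_⟩
  obtain ⟨n, hn1, hn2, hn3⟩ := exists_smolyak_order (A := 4 ^ d) (by positivity) (d - 1) hm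
  obtain ⟨N, L, hN, hL, hLf⟩ := exists_smolyak d n
  refine (recovE_Wclass_one_le hr hL (hN.trans hn1) fun y => ?_).trans
    ((ENNReal.ofReal_rpow_of_nonneg (by positivity) (by norm_num)).le.trans
      (ENNReal.ofReal_le_ofReal ?_)) (b := ENNReal.ofReal
        (C * (((2 : ℝ) ^ (1 - 2 * r)) ^ n * ((n : ℝ) + 1) ^ (d - 1))) ^ (1 / 2 : ℝ))
  · refine le_trans (le_of_eq (lintegral_congr fun x => ?_)) (herr n y)
    rw [← hLf fun j z => bernoulliKernel1 r (z - y j)]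
    rfl
  · have := hrate m n hm hn2 hn3
    rwa [Nat.cast_sub hd, Nat.cast_one] at this

end
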